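/- For every N ∈ ℕ, ∫_0^π ( N/π − sin(2Nθ)/(2π sin θ) ) / sin²(θ/2) dθ = 2N². -/

import Mathlib

open Real

/-- The Dirichlet kernel in closed form. -/
lemma sin_half_mul_dirichlet_sum (k : ℕ) (θ : ℝ) :
    Real.sin (θ / 2) * (1 + 2 * ∑ j ∈ Finset.range k, Real.cos ((j + 1 : ℝ) * θ)) =
      Real.sin ((k + 1 / 2 : ℝ) * θ) := by
  induction k with
  | zero => simp; ring_nf
  | succ k ih =>
    have h := Real.sin_sub_sin (((k + 1 : ℕ) + 1 / 2 : ℝ) * θ) ((k + 1 / 2 : ℝ) * θ)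
    rw [Finset.sum_range_succ]
    push_cast at h ⊢
    rw [show ((k + 1 + 1 / 2 : ℝ) * θ - (k + 1 / 2) * θ) / 2 = θ / 2 by ring,
      show ((k + 1 + 1 / 2 : ℝ) * θ + (k + 1 / 2) * θ) / 2 = (k + 1) * θ by ring] at h
    linear_combination ih - h

/-- The Fejér kernel in closed form. -/
lemma two_mul_sin_half_sq_mul_fejer_sum (m : ℕ) (θ : ℝ) :
    2 * Real.sin (θ / 2) ^ 2 *
        ∑ k ∈ Finset.range m, (1 + 2 * ∑ j ∈ Finset.range k, Real.cos ((j + 1 : ℝ) * θ)) =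
      1 - Real.cos (m * θ) := by
  induction m with
  | zero => simp
  | succ m ih =>
    have h := Real.cos_sub_cos (m * θ) ((m + 1 : ℕ) * θ)
    have hd := sin_half_mul_dirichlet_sum m θ
    rw [Finset.sum_range_succ]
    push_cast at h ⊢
    rw [show (m * θ + (m + 1) * θ) / 2 = (m + 1 / 2 : ℝ) * θ by ring,
      show (m * θ - (m + 1) * θ) / 2 = -(θ / 2) by ring, Real.sin_neg] at h
    linear_combination ih + 2 * Real.sin (θ / 2) * hd - h

lemma two_mul_sin_mul_sum_cos_odd (N : ℕ) (θ : ℝ) :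
    2 * Real.sin θ * ∑ k ∈ Finset.range N, Real.cos ((2 * k + 1 : ℕ) * θ) =
      Real.sin (2 * N * θ) := by
  induction N with
  | zero => simp
  | succ N ih =>
    have h := Real.sin_sub_sin (2 * (N + 1 : ℕ) * θ) (2 * N * θ)
    rw [Finset.sum_range_succ]
    push_cast at h ih ⊢
    rw [show (2 * (N + 1) * θ - 2 * N * θ) / 2 = θ by ring,
      show (2 * (N + 1) * θ + 2 * N * θ) / 2 = (2 * N + 1) * θ by ring] at h
    linear_combination ih - h

lemma integral_cos_nat_succ_mul (j : ℕ) :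
    ∫ θ in (0 : ℝ)..π, Real.cos ((j + 1 : ℝ) * θ) = 0 := by
  have hj : (j + 1 : ℝ) ≠ 0 := by positivity
  have h := Real.sin_nat_mul_pi (j + 1)
  push_cast at h
  rw [intervalIntegral.integral_comp_mul_left (fun x => Real.cos x) hj]
  simp [h]

lemma integral_dirichlet_sum (k : ℕ) :
    ∫ θ in (0 : ℝ)..π, (1 + 2 * ∑ j ∈ Finset.range k, Real.cos ((j + 1 : ℝ) * θ)) = π := by
  rw [intervalIntegral.integral_add (by simp)
      (Continuous.intervalIntegrable (by fun_prop) _ _),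
    intervalIntegral.integral_const_mul, intervalIntegral.integral_finsetSum
      fun j _ => Continuous.intervalIntegrable (by fun_prop) _ _]
  simp [integral_cos_nat_succ_mul]

lemma integral_fejer_sum (m : ℕ) :
    ∫ θ in (0 : ℝ)..π,
      ∑ k ∈ Finset.range m, (1 + 2 * ∑ j ∈ Finset.range k, Real.cos ((j + 1 : ℝ) * θ)) =
        m * π := by
  rw [intervalIntegral.integral_finsetSum
      fun k _ => Continuous.intervalIntegrable (by fun_prop) _ _]
  simp [integral_dirichlet_sum]

lemma onePoint_correlation_div_sin_sq_eq_sum_fejer (N : ℕ) {θ : ℝ} (hθ : θ ∈ Set.Ioo 0 π) :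
    ((N : ℝ) / π - Real.sin (2 * N * θ) / (2 * π * Real.sin θ)) / Real.sin (θ / 2) ^ 2 =
      2 / π * ∑ n ∈ Finset.range N, ∑ k ∈ Finset.range (2 * n + 1),
        (1 + 2 * ∑ j ∈ Finset.range k, Real.cos ((j + 1 : ℝ) * θ)) := by
  have hs : Real.sin θ ≠ 0 := (Real.sin_pos_of_mem_Ioo hθ).ne'
  have hs2 : Real.sin (θ / 2) ≠ 0 :=
    (Real.sin_pos_of_pos_of_lt_pi (by linarith [hθ.1]) (by linarith [hθ.1, hθ.2])).ne'
  have hsum : 2 * Real.sin (θ / 2) ^ 2 *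
      ∑ n ∈ Finset.range N, ∑ k ∈ Finset.range (2 * n + 1),
        (1 + 2 * ∑ j ∈ Finset.range k, Real.cos ((j + 1 : ℝ) * θ)) =
      N - ∑ n ∈ Finset.range N, Real.cos ((2 * n + 1 : ℕ) * θ) := by
    rw [Finset.mul_sum, Finset.sum_congr rfl
      fun n _ => two_mul_sin_half_sq_mul_fejer_sum (2 * n + 1) θ, Finset.sum_sub_distrib]
    simp
  rw [div_eq_iff (pow_ne_zero 2 hs2), ← two_mul_sin_mul_sum_cos_odd]
  have hcancel : ∀ C : ℝ, 2 * Real.sin θ * C / (2 * π * Real.sin θ) = C / π := by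
    intro C
    field_simp
  rw [hcancel]
  linear_combination -hsum / π

/-- `∫₀^π R₁(θ)/sin²(θ/2) dθ = 2N²`, where `R₁` is the one-point correlation function of
`SO(2N+1)`. -/
theorem integral_onePoint_correlation_div_sin_sq (N : ℕ) :
    ∫ θ in (0 : ℝ)..π,
        ((N : ℝ) / π - Real.sin (2 * N * θ) / (2 * π * Real.sin θ)) / Real.sin (θ / 2) ^ 2 =
      2 * (N : ℝ) ^ 2 := by
  have hodd : ∑ n ∈ Finset.range N, ((2 * n + 1 : ℕ) : ℝ) = (N : ℝ) ^ 2 := by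
    induction N with
    | zero => simp
    | succ N ih => rw [Finset.sum_range_succ, ih]; push_cast; ring
  rw [intervalIntegral.integral_of_le Real.pi_pos.le, MeasureTheory.integral_Ioc_eq_integral_Ioo,
    MeasureTheory.setIntegral_congr_fun measurableSet_Ioo
      fun θ hθ => onePoint_correlation_div_sin_sq_eq_sum_fejer N hθ,
    ← MeasureTheory.integral_Ioc_eq_integral_Ioo,
    ← intervalIntegral.integral_of_le Real.pi_pos.le,
    intervalIntegral.integral_const_mul, intervalIntegral.integral_finsetSum
      fun n _ => Continuous.intervalIntegrable (by fun_prop) _ _,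
    Finset.sum_congr rfl fun n _ => integral_fejer_sum (2 * n + 1), ← Finset.sum_mul, hodd]
  field_simp
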